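/- Under the commutation relation S^i ∘ K^i = K^{i+1} ∘ S^i, the operators S^i form a complex: S^{i+1} ∘ S^i = 0 for all i. -/

import Mathlib

/-- Under the commutation relation `S i ∘ K i = K (i+1) ∘ S i`,
the operators `S i := d i ∘ K i − K (i+1) ∘ d i` form a complex:
`S (i+1) ∘ S i = 0` for all `i`. -/
theorem bgg_S_complex
    (Z : ℕ → Type*) [∀ i, NormedAddCommGroup (Z i)]
    [∀ i, InnerProductSpace ℝ (Z i)] [∀ i, CompleteSpace (Z i)]
    (d : ∀ i, Z i →L[ℝ] Z (i + 1)) (K : ∀ i, Z i →L[ℝ] Z i)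
    (S : ∀ i, Z i →L[ℝ] Z (i + 1))
    (hdd : ∀ i, (d (i + 1)).comp (d i) = 0)
    (hS : ∀ i, S i = (d i).comp (K i) - (K (i + 1)).comp (d i))
    (hSK : ∀ i, (S i).comp (K i) = (K (i + 1)).comp (S i)) :
    ∀ i, (S (i + 1)).comp (S i) = 0 := by
  intro i
  have hdd' : ∀ j (y : Z j), d (j + 1) (d j y) = 0 := fun j y => DFunLike.congr_fun (hdd j) y
  have hS' : ∀ j (y : Z j), S j y = d j (K j y) - K (j + 1) (d j y) := fun j y =>
    DFunLike.congr_fun (hS j) y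
  have hdouble : ∀ j (y : Z j), d j (K j (K j y)) + K (j + 1) (K (j + 1) (d j y)) =
      (2 : ℝ) • K (j + 1) (d j (K j y)) := by
    intro j y
    have h : S j (K j y) = K (j + 1) (S j y) := DFunLike.congr_fun (hSK j) y
    rw [hS', hS', map_sub] at h
    linear_combination (norm := module) h
  ext x
  have hleft := congrArg (d (i + 1)) (hdouble i x)
  have hright := hdouble (i + 1) (d i x)
  simp only [map_add, map_smul, hdd', map_zero, zero_add, add_zero] at hleft hright
  simp only [ContinuousLinearMap.comp_apply, zero_apply, hS', map_sub, hdd',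
    map_zero]
  linear_combination (norm := module) (-(1 / 2) : ℝ) • hleft - (1 / 2 : ℝ) • hright
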